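/- Let G = (V,E) be an oriented graph without coloops (bridges). Then the modular flow polynomial φ̄_G has degree ξ(G) and leading coefficient 1. -/

import Mathlib

namespace ModularFlows

attribute [local instance] Classical.propDecidable

variable {V E : Type}

/-- A directed (simple) cycle, given by its cyclically ordered edges
`c 0, c 1, …, c n`: consecutive edges are head-to-tail compatible (also from
`c n` back to `c 0`) and the start vertices are pairwise distinct. -/
def IsDirCycle (src tgt : E → V) (n : ℕ) (c : Fin (n + 1) → E) : Prop :=
  Function.Injective (fun i => src (c i)) ∧ ∀ i, tgt (c i) = src (c (i + 1))

/-- An oriented graph is totally cyclic if every edge lies on a directed cycle. -/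
def TotallyCyclic (src tgt : E → V) : Prop :=
  ∀ e : E, ∃ (n : ℕ) (c : Fin (n + 1) → E), IsDirCycle src tgt n c ∧ e ∈ Set.range c

/-- An oriented graph is acyclic if it contains no directed cycle. -/
def Acyclic (src tgt : E → V) : Prop :=
  ∀ (n : ℕ) (c : Fin (n + 1) → E), ¬ IsDirCycle src tgt n c

/-- Source map of the reorientation of the graph along `σ`. -/
noncomputable def rsrc (src tgt : E → V) (σ : Set E) (e : E) : V :=
  if e ∈ σ then tgt e else src e

/-- Target map of the reorientation of the graph along `σ`. -/
noncomputable def rtgt (src tgt : E → V) (σ : Set E) (e : E) : V :=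
  if e ∈ σ then src e else tgt e

/-- A `ZMod k`-flow: conservation of flow at every vertex. -/
def IsFlow [Fintype E] (src tgt : E → V) (k : ℕ) (f : E → ZMod k) : Prop :=
  ∀ v : V, (∑ e : E, if tgt e = v then f e else 0) = ∑ e : E, if src e = v then f e else 0

/-- Start vertex of an edge traversed forwards (`true`) or backwards (`false`). -/
def uSrc (src tgt : E → V) (p : E × Bool) : V := if p.2 then src p.1 else tgt p.1

/-- End vertex of an edge traversed forwards (`true`) or backwards (`false`). -/
def uTgt (src tgt : E → V) (p : E × Bool) : V := if p.2 then tgt p.1 else src p.1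

/-- A cycle of the underlying undirected graph, with a chosen traversal
direction: a cyclic sequence of edges, each traversed forwards or backwards,
consecutive ones compatible, visiting pairwise distinct vertices. -/
def IsUCycle (src tgt : E → V) (n : ℕ) (c : Fin (n + 1) → E × Bool) : Prop :=
  Function.Injective (fun i => uSrc src tgt (c i)) ∧
    ∀ i, uTgt src tgt (c i) = uSrc src tgt (c (i + 1))

/-- A `ZMod l`-tension: the signed sum over every cycle of the underlying
undirected graph (forward edges positively, backward edges negatively) vanishes. -/
def IsTension (src tgt : E → V) (l : ℕ) (t : E → ZMod l) : Prop :=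
  ∀ (n : ℕ) (c : Fin (n + 1) → E × Bool), IsUCycle src tgt n c →
    (∑ i : Fin (n + 1), if (c i).2 then t (c i).1 else - t (c i).1) = 0

/-- Adjacency via an edge of `S` (its equivalence closure gives the components
of the spanning subgraph `(V, S)`). -/
def linkRel (src tgt : E → V) (S : Set E) (u v : V) : Prop :=
  ∃ e ∈ S, src e = u ∧ tgt e = v

/-- Number of (weakly) connected components of the spanning subgraph `(V, S)`. -/
noncomputable def ncompSub (src tgt : E → V) (S : Set E) : ℕ :=
  Nat.card (Quot (linkRel src tgt S))

/-- Number of (weakly) connected components. -/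
noncomputable def ncomp (src tgt : E → V) : ℕ :=
  ncompSub src tgt Set.univ

/-- The cyclotomic number `ξ(G) = |E| - |V| + c(G)`. -/
noncomputable def xi [Fintype V] [Fintype E] (src tgt : E → V) : ℤ :=
  (Fintype.card E : ℤ) - (Fintype.card V : ℤ) + (ncomp src tgt : ℤ)

/-- Source map of the contraction `G/S`: vertices are identified along edges of
`S`, and the edges of `S` are removed. -/
def csrc (src tgt : E → V) (S : Set E) (e : {e : E // e ∉ S}) :
    Quot (linkRel src tgt S) :=
  Quot.mk _ (src e.1)

/-- Target map of the contraction `G/S`. -/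
def ctgt (src tgt : E → V) (S : Set E) (e : {e : E // e ∉ S}) :
    Quot (linkRel src tgt S) :=
  Quot.mk _ (tgt e.1)

/-- Source (or target) map of the deletion `G∖S`. -/
def dsrc (src : E → V) (S : Set E) (e : {e : E // e ∉ S}) : V := src e.1

/-- Source (or target) map of the restriction `G[S]`. -/
def ressrc (src : E → V) (S : Set E) (e : {e : E // e ∈ S}) : V := src e.1

/-- `σ` is a totally cyclic reorientation of the contraction `G/S`. -/
def TCReorContr (src tgt : E → V) (S σ : Set E) : Prop :=
  TotallyCyclic (rsrc (csrc src tgt S) (ctgt src tgt S) {e | e.1 ∈ σ})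
                (rtgt (csrc src tgt S) (ctgt src tgt S) {e | e.1 ∈ σ})

/-- `σ` is a totally cyclic reorientation of the deletion `G∖S`. -/
def TCReorDel (src tgt : E → V) (S σ : Set E) : Prop :=
  TotallyCyclic (rsrc (dsrc src S) (dsrc tgt S) {e | e.1 ∈ σ})
                (rtgt (dsrc src S) (dsrc tgt S) {e | e.1 ∈ σ})

/-- `σ` is an acyclic reorientation of the deletion `G∖S`. -/
def AcyclicReorDel (src tgt : E → V) (S σ : Set E) : Prop :=
  Acyclic (rsrc (dsrc src S) (dsrc tgt S) {e | e.1 ∈ σ})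
          (rtgt (dsrc src S) (dsrc tgt S) {e | e.1 ∈ σ})

/-- Entry of the incidence matrix `A_G` at vertex `v` and edge `e`. -/
noncomputable def inc (src tgt : E → V) (v : V) (e : E) : ℤ :=
  (if tgt e = v then 1 else 0) - (if src e = v then 1 else 0)

/-- The number of nowhere-zero `ZMod k`-flows. -/
noncomputable def nzFlowCount [Fintype E] (src tgt : E → V) (k : ℕ) : ℕ :=
  Nat.card {f : E → ZMod k // IsFlow src tgt k f ∧ ∀ e, f e ≠ 0}

/-- The number of nowhere-zero `ZMod l`-tensions. -/
noncomputable def nzTensionCount (src tgt : E → V) (l : ℕ) : ℕ :=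
  Nat.card {t : E → ZMod l // IsTension src tgt l t ∧ ∀ e, t e ≠ 0}

/-- The rank `r(S) = |V| - c(V,S)` of an edge set `S`. -/
noncomputable def rk [Fintype V] (src tgt : E → V) (S : Set E) : ℕ :=
  Fintype.card V - ncompSub src tgt S

/-- The Tutte polynomial `t_G(x,y) = Σ_{S ⊆ E} (x-1)^{r(E)-r(S)} (y-1)^{|S|-r(S)}`. -/
noncomputable def tutte [Fintype V] [Fintype E] (src tgt : E → V) (x y : ℚ) : ℚ :=
  ∑ S : Finset E,
    (x - 1) ^ (rk src tgt Set.univ - rk src tgt ↑S) * (y - 1) ^ (S.card - rk src tgt ↑S)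

/-- `e` is a coloop (bridge): deleting it increases the number of components. -/
def IsColoop (src tgt : E → V) (e : E) : Prop :=
  ncompSub src tgt ({e} : Set E)ᶜ = ncomp src tgt + 1

/-- The number of pairs `(f, σ)` of a `ZMod k`-flow `f` and a totally cyclic
reorientation `σ ⊆ E ∖ supp f` of the contraction `G/supp f`. -/
noncomputable def phiR [Fintype E] (src tgt : E → V) (k : ℕ) : ℕ :=
  Nat.card {p : (E → ZMod k) × Set E //
    IsFlow src tgt k p.1 ∧ p.2 ⊆ {e | p.1 e = 0} ∧
    TCReorContr src tgt {e | p.1 e ≠ 0} p.2}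

/-- The in-degree sequence of the reorientation of the graph along `σ`. -/
noncomputable def indegSeq [Fintype E] (src tgt : E → V) (σ : Set E) (v : V) : ℤ :=
  (Nat.card {e : E // rtgt src tgt σ e = v} : ℤ)

/-- The vector `A_G · e_σ`, where `e_σ` is the characteristic vector of `σ`. -/
noncomputable def AeVec [Fintype E] (src tgt : E → V) (σ : Set E) (v : V) : ℤ :=
  ∑ e : E, if e ∈ σ then inc src tgt v e else 0

/-- `τ'` is obtained from `τ` by reversing a directed cycle of `_τG`. -/
def cycleReverse (src tgt : E → V) (τ τ' : Set E) : Prop :=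
  ∃ (n : ℕ) (c : Fin (n + 1) → E),
    IsDirCycle (rsrc src tgt τ) (rtgt src tgt τ) n c ∧ τ' = symmDiff τ (Set.range c)

/-- The incidence matrix of an oriented graph, with entries in a ring `R`. -/
noncomputable def incMatrix (R : Type) [Ring R] (src tgt : E → V) : Matrix V E R :=
  fun v e => (if tgt e = v then 1 else 0) - (if src e = v then 1 else 0)

theorem incMatrix_mulVec_apply {R : Type} [Ring R] [Fintype E] (src tgt : E → V)
    (f : E → R) (v : V) :
    (incMatrix R src tgt).mulVec f v =
      (∑ e : E, if tgt e = v then f e else 0) - ∑ e : E, if src e = v then f e else 0 := by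
  simp [Matrix.mulVec, dotProduct, incMatrix, sub_mul, Finset.sum_sub_distrib]

theorem incMatrix_transpose_mulVec_apply {R : Type} [Ring R] [Fintype V] (src tgt : E → V)
    (x : V → R) (e : E) :
    (incMatrix R src tgt).transpose.mulVec x e = x (tgt e) - x (src e) := by
  simp [Matrix.mulVec, dotProduct, incMatrix, sub_mul, Finset.sum_sub_distrib]

/-- The vertex potentials with zero coboundary are the functions on the set of components. -/
noncomputable def kerTransposeEquiv (R : Type) [CommRing R] [Fintype V] (src tgt : E → V) :
    LinearMap.ker (incMatrix R src tgt).transpose.mulVecLin ≃ₗ[R]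
      (Quot (linkRel src tgt Set.univ) → R) where
  toFun x := Quot.lift x.1 (by
    rintro _ _ ⟨e, -, rfl, rfl⟩
    have h := congrFun (LinearMap.mem_ker.1 x.2) e
    rw [Matrix.mulVecLin_apply, incMatrix_transpose_mulVec_apply] at h
    exact (sub_eq_zero.1 h).symm)
  map_add' x y := by ext ⟨v⟩; rfl
  map_smul' a x := by ext ⟨v⟩; rfl
  invFun y := ⟨fun v => y (Quot.mk _ v), by
    rw [LinearMap.mem_ker]
    ext e
    rw [Matrix.mulVecLin_apply, incMatrix_transpose_mulVec_apply]
    exact sub_eq_zero.2 (congrArg y (Quot.sound ⟨e, trivial, rfl, rfl⟩)).symm⟩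
  left_inv x := rfl
  right_inv y := by ext ⟨v⟩; rfl

theorem finrank_ker_incMatrix (F : Type) [Field F] [Fintype V] [Fintype E] (src tgt : E → V) :
    Module.finrank F (LinearMap.ker (incMatrix F src tgt).mulVecLin) + Fintype.card V =
      Fintype.card E + ncomp src tgt := by
  have h₁ := LinearMap.finrank_range_add_finrank_ker (incMatrix F src tgt).mulVecLin
  have h₂ := LinearMap.finrank_range_add_finrank_ker (incMatrix F src tgt).transpose.mulVecLin
  have h₃ := (incMatrix F src tgt).rank_transpose
  have h₄ : Module.finrank F (LinearMap.ker (incMatrix F src tgt).transpose.mulVecLin) =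
      ncomp src tgt := by
    have : Fintype (Quot (linkRel src tgt Set.univ)) := Fintype.ofFinite _
    rw [(kerTransposeEquiv F src tgt).finrank_eq, Module.finrank_fintype_fun_eq_card,
      ncomp, ncompSub, Nat.card_eq_fintype_card]
  rw [Matrix.rank, Matrix.rank] at h₃
  rw [Module.finrank_fintype_fun_eq_card] at h₁ h₂
  omega

theorem ncomp_comp_val (src tgt : E → V) (S : Set E) :
    ncomp (fun e : S => src e) (fun e : S => tgt e) = ncompSub src tgt S := by
  have : linkRel (fun e : S => src e) (fun e : S => tgt e) Set.univ = linkRel src tgt S := by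
    ext u v
    simp [linkRel, and_left_comm]
  rw [ncomp, ncompSub, this, ncompSub]

theorem incMatrix_mulVec_comp_val {R : Type} [Ring R] [Fintype E] (src tgt : E → V) (e : E)
    (f : E → R) (hf : f e = 0) :
    (incMatrix R (fun a : ({e}ᶜ : Set E) => src a) (fun a => tgt a)).mulVec (fun a => f a) =
      (incMatrix R src tgt).mulVec f := by
  have key (g : E → V) (v : V) : (∑ a : ({e}ᶜ : Set E), if g a = v then f a else 0) =
      ∑ a : E, if g a = v then f a else 0 := by
    rw [← Finset.sum_subset (Finset.subset_univ {a | a ∈ ({e}ᶜ : Set E)})]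
    · exact (Finset.sum_subtype _ (by simp) (fun a => if g a = v then f a else 0)).symm
    · intro a _ ha
      have : a = e := by simpa using ha
      simp [this, hf]
  ext v
  rw [incMatrix_mulVec_apply, incMatrix_mulVec_apply, key, key]

/-- The flows are not all zero at an edge which is not a coloop. -/
theorem exists_ker_apply_ne_zero (F : Type) [Field F] [Fintype V] [Fintype E] (src tgt : E → V)
    (e : E) (he : ¬ IsColoop src tgt e) :
    ∃ f ∈ LinearMap.ker (incMatrix F src tgt).mulVecLin, f e ≠ 0 := by
  by_contra! h
  apply he
  let K := LinearMap.ker (incMatrix F src tgt).mulVecLin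
  let K' := LinearMap.ker
    (incMatrix F (fun a : ({e}ᶜ : Set E) => src a) (fun a => tgt a)).mulVecLin
  let res : K →ₗ[F] K' := LinearMap.codRestrict K'
    ((LinearMap.funLeft F F (Subtype.val : ({e}ᶜ : Set E) → E)).domRestrict K) (fun f => by
      have hf := f.2
      rw [LinearMap.mem_ker, Matrix.mulVecLin_apply] at hf ⊢
      exact (incMatrix_mulVec_comp_val src tgt e f.1 (h _ f.2)).trans hf)
  have hbij : Function.Bijective res := by
    constructor
    · intro f g hfg
      ext a
      by_cases ha : a = e
      · rw [ha, h _ f.2, h _ g.2]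
      · exact congrFun (congrArg Subtype.val hfg) ⟨a, ha⟩
    · intro g
      let f : E → F := fun a => if ha : a ∈ ({e}ᶜ : Set E) then g.1 ⟨a, ha⟩ else 0
      have hfe : f e = 0 := by simp [f]
      have hfg : (fun a : ({e}ᶜ : Set E) => f a) = g.1 := by
        ext a
        exact dif_pos a.2
      refine ⟨⟨f, ?_⟩, Subtype.ext hfg⟩
      have hg := g.2
      rw [LinearMap.mem_ker, Matrix.mulVecLin_apply] at hg ⊢
      rw [← incMatrix_mulVec_comp_val src tgt e f hfe, hfg, hg]
  have h₁ := (LinearEquiv.ofBijective res hbij).finrank_eq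
  have h₂ := finrank_ker_incMatrix F src tgt
  have h₃ := finrank_ker_incMatrix F (fun a : ({e}ᶜ : Set E) => src a) (fun a => tgt a)
  rw [ncomp_comp_val] at h₃
  have h₄ : Fintype.card ({e}ᶜ : Set E) + 1 = Fintype.card E := by
    rw [Fintype.card_compl_set]
    have : 0 < Fintype.card E := Fintype.card_pos_iff.2 ⟨e⟩
    simp
    omega
  change Module.finrank F K = Module.finrank F K' at h₁
  change Module.finrank F K + _ = _ at h₂
  change Module.finrank F K' + _ = _ at h₃
  rw [IsColoop]
  omega

theorem isFlow_iff_mem_ker [Fintype E] (src tgt : E → V) (k : ℕ) (f : E → ZMod k) :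
    IsFlow src tgt k f ↔ f ∈ LinearMap.ker (incMatrix (ZMod k) src tgt).mulVecLin := by
  rw [LinearMap.mem_ker, Matrix.mulVecLin_apply, funext_iff]
  simp only [incMatrix_mulVec_apply, Pi.zero_apply, sub_eq_zero]
  rfl

/-- A proper coordinate hyperplane section of a subspace over `ZMod p` is smaller by a factor
of at least `p`. -/
theorem natCard_apply_eq_zero_mul_le [Fintype E] (p : ℕ) [Fact p.Prime]
    (K : Submodule (ZMod p) (E → ZMod p)) (e : E) (he : ∃ f ∈ K, f e ≠ 0) :
    Nat.card {f : E → ZMod p // f ∈ K ∧ f e = 0} * p ≤ p ^ Module.finrank (ZMod p) K := by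
  let L := K ⊓ LinearMap.ker (LinearMap.proj (R := ZMod p) (φ := fun _ : E => ZMod p) e)
  have hlt : L < K := by
    obtain ⟨f, hf, hfe⟩ := he
    exact lt_of_le_of_ne inf_le_left fun h => hfe (h ▸ hf : f ∈ L).2
  have hcard : Nat.card {f : E → ZMod p // f ∈ K ∧ f e = 0} =
      p ^ Module.finrank (ZMod p) L := by
    have h := Module.natCard_eq_pow_finrank (K := ZMod p) (V := L)
    rw [Nat.card_zmod] at h
    exact h
  rw [hcard, ← pow_succ]
  exact Nat.pow_le_pow_right (Fact.out : p.Prime).pos (Submodule.finrank_lt_finrank_of_lt hlt)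

theorem nzFlowCount_bounds [Fintype V] [Fintype E] (src tgt : E → V)
    (hcl : ∀ e : E, ¬ IsColoop src tgt e) (p : ℕ) (hp : p.Prime) :
    ∃ n : ℕ, n + Fintype.card V = Fintype.card E + ncomp src tgt ∧
      nzFlowCount src tgt p ≤ p ^ n ∧
      p ^ n * p ≤ nzFlowCount src tgt p * p + Fintype.card E * p ^ n := by
  have : Fact p.Prime := ⟨hp⟩
  let K := LinearMap.ker (incMatrix (ZMod p) src tgt).mulVecLin
  have hK : Nat.card {f : E → ZMod p // f ∈ K} = p ^ Module.finrank (ZMod p) K := by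
    have h := Module.natCard_eq_pow_finrank (K := ZMod p) (V := K)
    rw [Nat.card_zmod] at h
    exact h
  refine ⟨Module.finrank (ZMod p) K, finrank_ker_incMatrix (ZMod p) src tgt, ?_, ?_⟩
  · rw [← hK]
    exact Nat.card_mono (Set.toFinite {f : E → ZMod p | f ∈ K})
      fun f hf => (isFlow_iff_mem_ker src tgt p f).1 hf.1
  · have hle : p ^ Module.finrank (ZMod p) K ≤
        nzFlowCount src tgt p + ∑ e, Nat.card {f : E → ZMod p // f ∈ K ∧ f e = 0} := by
      rw [← hK, nzFlowCount]
      simp only [isFlow_iff_mem_ker, Nat.card_eq_fintype_card, Fintype.card_subtype]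
      refine (Finset.card_le_card ?_).trans ((Finset.card_union_le _ _).trans
        (Nat.add_le_add_left Finset.card_biUnion_le _))
      intro f hf
      by_cases h : ∀ e, f e ≠ 0
      · simp_all [K]
      · push Not at h
        simp_all [K]
    calc p ^ Module.finrank (ZMod p) K * p
        ≤ (nzFlowCount src tgt p + ∑ e, Nat.card {f : E → ZMod p // f ∈ K ∧ f e = 0}) * p :=
          Nat.mul_le_mul_right _ hle
      _ = nzFlowCount src tgt p * p +
          ∑ e, Nat.card {f : E → ZMod p // f ∈ K ∧ f e = 0} * p := by
          rw [add_mul, Finset.sum_mul]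
      _ ≤ _ := by
          refine Nat.add_le_add_left ((Finset.sum_le_card_nsmul _ _ _ fun e _ =>
            natCard_apply_eq_zero_mul_le p K e
              (exists_ker_apply_ne_zero (ZMod p) src tgt e (hcl e))).trans ?_) _
          simp

/-- A polynomial taking values of size `O(x ^ n / x)` at infinitely many naturals has degree
less than `n`. -/
theorem degree_lt_of_frequently_abs_eval_mul_le (R : Polynomial ℚ) (n : ℕ) (C : ℚ)
    (h : ∃ᶠ m : ℕ in Filter.atTop, |R.eval (m : ℚ)| * m ≤ C * (m : ℚ) ^ n) :
    R.degree < n := by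
  by_contra! hn
  have hR : R ≠ 0 := by
    rintro rfl
    simp at hn
  have hdeg : (Polynomial.X ^ n : Polynomial ℚ).degree < (R * Polynomial.X).degree := by
    rw [Polynomial.degree_X_pow, Polynomial.degree_mul_X]
    rw [Polynomial.degree_eq_natDegree hR] at hn ⊢
    norm_cast at hn ⊢
    omega
  have ho := (Polynomial.isLittleO_atTop_of_degree_lt _ _ hdeg).def
    (c := ((|C| + 1 : ℚ) : ℝ)⁻¹) (by positivity)
  obtain ⟨m, ⟨hm, hm₁⟩, hm₂⟩ := (h.and_eventually (Filter.eventually_gt_atTop 0)).and_eventually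
    (tendsto_natCast_atTop_atTop.eventually ho) |>.exists
  have hm₀ : (0 : ℚ) < m := by exact_mod_cast hm₁
  rw [← Rat.norm_cast_real, ← Rat.norm_cast_real, Real.norm_eq_abs, Real.norm_eq_abs] at hm₂
  have hm₃ : (m : ℚ) ^ n ≤ (|C| + 1)⁻¹ * (|R.eval (m : ℚ)| * m) := by
    rw [Polynomial.eval_mul, Polynomial.eval_X, Polynomial.eval_pow, Polynomial.eval_X] at hm₂
    have h' : |(m : ℚ) ^ n| ≤ (|C| + 1)⁻¹ * |R.eval (m : ℚ) * m| := by exact_mod_cast hm₂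
    rwa [abs_mul, abs_of_pos hm₀, abs_of_pos (pow_pos hm₀ n)] at h'
  have hC : (0 : ℚ) < |C| + 1 := by positivity
  rw [inv_mul_eq_div, le_div_iff₀ hC] at hm₃
  have := pow_pos hm₀ n
  nlinarith [le_abs_self C]

/-- If `G` has no coloops, the modular flow polynomial has degree `ξ(G)` and
leading coefficient `1`. -/
theorem flow_polynomial_degree_leadingCoeff {V E : Type} [Fintype V] [Fintype E]
    (src tgt : E → V) (hcl : ∀ e : E, ¬ IsColoop src tgt e)
    (P : Polynomial ℚ)
    (hP : ∀ m : ℕ, 0 < m → P.eval (m : ℚ) = nzFlowCount src tgt m) :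
    (P.natDegree : ℤ) = xi src tgt ∧ P.leadingCoeff = 1 := by
  obtain ⟨n, hn⟩ : ∃ n : ℕ, n + Fintype.card V = Fintype.card E + ncomp src tgt :=
    (nzFlowCount_bounds src tgt hcl 2 Nat.prime_two).imp fun _ h => h.1
  have hdeg : (P - Polynomial.X ^ n).degree < (n : WithBot ℕ) := by
    refine degree_lt_of_frequently_abs_eval_mul_le _ n (Fintype.card E) ?_
    refine Filter.frequently_atTop.2 fun a => ?_
    obtain ⟨p, hap, hp⟩ := Nat.exists_infinite_primes a
    obtain ⟨n', hn', hle, hge⟩ := nzFlowCount_bounds src tgt hcl p hp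
    obtain rfl : n' = n := by omega
    refine ⟨p, hap, ?_⟩
    have hle' : (nzFlowCount src tgt p : ℚ) ≤ (p : ℚ) ^ n' := by exact_mod_cast hle
    have hge' : (p : ℚ) ^ n' * p ≤
        nzFlowCount src tgt p * p + Fintype.card E * (p : ℚ) ^ n' := by exact_mod_cast hge
    rw [Polynomial.eval_sub, Polynomial.eval_pow, Polynomial.eval_X, hP p hp.pos,
      abs_of_nonpos (by linarith)]
    linarith
  have hP' : P = Polynomial.X ^ n + (P - Polynomial.X ^ n) := by ring
  constructor
  · have : P.natDegree = n := by
      apply Polynomial.natDegree_eq_of_degree_eq_some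
      rw [hP', Polynomial.degree_add_eq_left_of_degree_lt (by rwa [Polynomial.degree_X_pow]),
        Polynomial.degree_X_pow]
    rw [this, xi]
    omega
  · rw [hP']
    exact Polynomial.monic_X_pow_add hdeg

end ModularFlows
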